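/- Let G be a finite group all of whose irreducible complex character degrees are powers of a fixed prime p. Then G is solvable. -/

import Mathlib

open Module

namespace Representation

variable {k G V : Type*} [Field k] [Monoid G] [AddCommGroup V] [Module k V]

theorem isIrreducible_iff_forall_submodule (ρ : Representation k G V) :
    IsIrreducible ρ ↔ Nontrivial V ∧
      ∀ U : Submodule k V, (∀ g, ∀ v ∈ U, ρ g v ∈ U) → U = ⊥ ∨ U = ⊤ := by
  constructor
  · intro h
    have hne : (⊥ : Submodule k V) ≠ ⊤ := fun H ↦
      bot_ne_top (α := Subrepresentation ρ) (Subrepresentation.toSubmodule_injective H)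
    refine ⟨(Submodule.nontrivial_iff k).mp ⟨⊥, ⊤, hne⟩, fun U hU ↦ ?_⟩
    exact (eq_bot_or_eq_top (⟨U, fun g v hv ↦ hU g v hv⟩ : Subrepresentation ρ)).imp
      (congrArg Subrepresentation.toSubmodule) (congrArg Subrepresentation.toSubmodule)
  · rintro ⟨hV, h⟩
    refine { exists_pair_ne := ⟨⊥, ⊤, fun H ↦ ?_⟩, eq_bot_or_eq_top := fun U ↦ ?_ }
    · exact bot_ne_top (α := Submodule k V) (congrArg Subrepresentation.toSubmodule H)
    · exact (h U.toSubmodule fun g v hv ↦ U.apply_mem_toSubmodule g hv).imp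
        (fun H ↦ Subrepresentation.toSubmodule_injective H)
        (fun H ↦ Subrepresentation.toSubmodule_injective H)

/-- Restricting functions that vanish on a finite set to one more point lowers the dimension of
a space of equivariant functions by `0` or by the dimension of the irreducible target. -/
theorem finrank_dvd_finrank_of_equivariant_functions {k G S : Type*} [Field k] [Group G] [Finite G]
    (N : Subgroup G) [N.Normal] [AddCommGroup S] [Module k S] [FiniteDimensional k S]
    (σ : Representation k N S) [IsIrreducible σ] (V : Submodule k (G → S))
    (hN : ∀ f ∈ V, ∀ (n : N) (g : G), f (n * g) = σ n (f g))
    (hG : ∀ f ∈ V, ∀ g : G, (fun x ↦ f (x * g)) ∈ V) :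
    finrank k S ∣ finrank k V := by
  classical
  have := Fintype.ofFinite G
  have hσ := ((isIrreducible_iff_forall_submodule σ).mp inferInstance).2
  let U (T : Finset G) : Submodule k (G → S) :=
    V ⊓ ⨅ t ∈ T, LinearMap.ker (LinearMap.proj (R := k) (φ := fun _ : G ↦ S) t)
  have hU (T : Finset G) (f : G → S) : f ∈ U T ↔ f ∈ V ∧ ∀ t ∈ T, f t = 0 := by
    simp [U, Submodule.mem_iInf]
  have hshift (T : Finset G) (f : G → S) (hf : f ∈ U T) (n : N) (g : G) :
      ∃ f' ∈ U T, f' g = σ n (f g) := by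
    rw [hU] at hf
    have hconj (x : G) : ∃ m : N, x * (g⁻¹ * n * g) = m * x :=
      ⟨⟨x * g⁻¹ * n * (x * g⁻¹)⁻¹, Subgroup.Normal.conj_mem ‹_› _ n.2 _⟩, by
        simp [mul_assoc]⟩
    refine ⟨fun x ↦ f (x * (g⁻¹ * n * g)), (hU _ _).mpr ⟨hG f hf.1 _, fun t ht ↦ ?_⟩, ?_⟩
    · obtain ⟨m, hm⟩ := hconj t
      rw [hm, hN f hf.1, hf.2 t ht, map_zero]
    · rw [← hN f hf.1]
      simp [mul_assoc]
  have hstep (T : Finset G) : finrank k S ∣ finrank k V ↔ finrank k S ∣ finrank k (U T) := by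
    induction T using Finset.induction_on with
    | empty => rw [show U ∅ = V by simp [U]]
    | insert g T _ ih =>
      rw [ih]
      let ev : U T →ₗ[k] S := LinearMap.proj g ∘ₗ (U T).subtype
      have hker : finrank k (LinearMap.ker ev) = finrank k (U (insert g T)) := by
        have : U (insert g T) = (LinearMap.ker ev).map (U T).subtype := by
          ext f
          simp [hU, ev, Submodule.mem_map]
          tauto
        rw [this]
        exact ((LinearMap.ker ev).equivMapOfInjective _ (U T).injective_subtype).finrank_eq
      have hrange : finrank k S ∣ finrank k (LinearMap.range ev) := by
        rcases hσ (LinearMap.range ev) (by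
          rintro n _ ⟨f, rfl⟩
          obtain ⟨f', hf', h⟩ := hshift T f f.2 n g
          exact ⟨⟨f', hf'⟩, h⟩) with h | h
        · rw [h, finrank_bot]
          exact dvd_zero _
        · rw [h, finrank_top]
      rw [← ev.finrank_range_add_finrank_ker, hker, Nat.dvd_add_right hrange]
  rw [hstep Finset.univ]
  have : U Finset.univ = ⊥ := by
    rw [eq_bot_iff]
    intro f hf
    exact funext fun t ↦ ((hU _ _).mp hf).2 t (Finset.mem_univ t)
  rw [this, finrank_bot]
  exact dvd_zero _

/-- Every irreducible representation of a normal subgroup has dimension dividing that of some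
irreducible representation of the whole group. -/
theorem exists_isIrreducible_finrank_dvd {k G S : Type} [Field k] [Group G] [Finite G]
    (N : Subgroup G) [N.Normal] [AddCommGroup S] [Module k S] [FiniteDimensional k S]
    (σ : Representation k N S) [IsIrreducible σ] :
    ∃ (V : Type) (_ : AddCommGroup V) (_ : Module k V) (_ : FiniteDimensional k V)
      (ρ : Representation k G V), IsIrreducible ρ ∧ finrank k S ∣ finrank k V := by
  classical
  have := Fintype.ofFinite G
  have hS : Nontrivial S := ((isIrreducible_iff_forall_submodule σ).mp inferInstance).1
  let P : Set (Submodule k (G → S)) := {V | V ≠ ⊥ ∧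
    (∀ f ∈ V, ∀ (n : N) (g : G), f (n * g) = σ n (f g)) ∧
    (∀ f ∈ V, ∀ g : G, (fun x ↦ f (x * g)) ∈ V)}
  have hP : P.Nonempty := by
    let C : Submodule k (G → S) :=
      { carrier := {f | ∀ (n : N) (g : G), f (n * g) = σ n (f g)}
        zero_mem' := by simp
        add_mem' := fun {a b} ha hb n g ↦ by simp [ha n g, hb n g]
        smul_mem' := fun c a ha n g ↦ by simp [ha n g] }
    refine ⟨C, fun hC ↦ ?_, fun f hf ↦ hf, fun f hf g n x ↦ ?_⟩
    · obtain ⟨s, hs⟩ := exists_ne (0 : S)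
      let f : G → S := fun g ↦ if hg : g ∈ N then σ ⟨g, hg⟩ s else 0
      have hf : f ∈ C := by
        intro n g
        by_cases hg : g ∈ N
        · have h : (n : G) * g ∈ N := N.mul_mem n.2 hg
          have : (⟨n * g, h⟩ : N) = n * ⟨g, hg⟩ := rfl
          simp only [f, dif_pos h, dif_pos hg, this, map_mul, Module.End.mul_apply]
        · have h : (n : G) * g ∉ N := fun h ↦ hg ((N.mul_mem_cancel_left n.2).mp h)
          simp only [f, dif_neg h, dif_neg hg, map_zero]
      rw [hC, Submodule.mem_bot] at hf
      apply hs
      have h1 : f 1 = s := by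
        have : (⟨1, N.one_mem⟩ : N) = 1 := rfl
        simp [f, this]
      rw [← h1, hf, Pi.zero_apply]
    · change f (n * x * g) = σ n (f (x * g))
      rw [mul_assoc, hf n]
  obtain ⟨V, ⟨hne, hN, hG⟩, hmin⟩ := WellFounded.has_min wellFounded_lt P hP
  let R (g : G) : (G → S) →ₗ[k] (G → S) := LinearMap.funLeft k S (· * g)
  let ρ : Representation k G V :=
    { toFun g := (R g).restrict fun f hf ↦ hG f hf g
      map_one' := by ext f x; simp [R, LinearMap.funLeft]
      map_mul' a b := by ext f x; simp [R, LinearMap.funLeft, mul_assoc] }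
  refine ⟨V, inferInstance, inferInstance, inferInstance, ρ, ?_,
    finrank_dvd_finrank_of_equivariant_functions N σ V hN hG⟩
  rw [isIrreducible_iff_forall_submodule]
  refine ⟨Submodule.nontrivial_iff_ne_bot.mpr hne, fun U hU ↦ or_iff_not_imp_left.mpr fun h ↦ ?_⟩
  by_contra htop
  refine hmin (U.map V.subtype) ⟨?_, ?_, ?_⟩ ?_
  · rwa [Ne, (Submodule.map_injective_of_injective V.injective_subtype).eq_iff'
      (Submodule.map_bot _)]
  · rintro _ ⟨f, -, rfl⟩
    exact hN f f.2
  · rintro _ ⟨f, hf, rfl⟩ g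
    exact ⟨ρ g f, hU g f hf, rfl⟩
  · refine lt_of_le_of_ne (Submodule.map_subtype_le V U) fun heq ↦ htop ?_
    apply Submodule.map_injective_of_injective V.injective_subtype
    simpa using heq

open CategoryTheory in
theorem simple_fdRep_of_isIrreducible {G V : Type} [Group G] [Finite G] [AddCommGroup V]
    [Module ℂ V] [FiniteDimensional ℂ V] (ρ : Representation ℂ G V) [IsIrreducible ρ] :
    Simple (FDRep.of ρ) := by
  rw [FDRep.simple_iff_end_is_rank_one, ← IsIrreducible.finrank_intertwiningMap_self ρ]
  exact ((FDRep.forget₂HomLinearEquiv (FDRep.of ρ) (FDRep.of ρ)).symm.trans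
    (Rep.homLinearEquiv _ _)).finrank_eq

end Representation

namespace Matrix

theorem isIntegral_trace_of_pow_eq_one {K : Type*} [Field K] [IsAlgClosed K] {n m : ℕ}
    (hm : 0 < m) (M : Matrix (Fin n) (Fin n) K) (hM : M ^ m = 1) : IsIntegral ℤ M.trace := by
  rw [trace_eq_sum_roots_charpoly]
  refine IsIntegral.multiset_sum fun μ hμ ↦ IsIntegral.of_pow hm ?_
  have h := mem_spectrum_of_isRoot_charpoly (Polynomial.isRoot_of_mem_roots hμ)
  have h' := spectrum.pow_mem_pow M m h
  rw [hM] at h'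
  have : Nontrivial (Matrix (Fin n) (Fin n) K) := by
    by_contra hn
    rw [not_nontrivial_iff_subsingleton] at hn
    rw [spectrum.of_subsingleton] at h
    exact h
  rw [spectrum.one_eq, Set.mem_singleton_iff] at h'
  rw [h']
  exact isIntegral_one

theorem trace_mulLeft_pi {K ι : Type*} [Field K] [Fintype ι] [DecidableEq ι] (d : ι → ℕ)
    (a : Π i, Matrix (Fin (d i)) (Fin (d i)) K) :
    LinearMap.trace K _ (LinearMap.mulLeft K a) = ∑ i, (d i : K) * (a i).trace := by
  rw [LinearMap.trace_eq_matrix_trace K (Pi.basis fun i ↦ Matrix.stdBasis K (Fin (d i)) (Fin (d i))),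
    Matrix.trace, Fintype.sum_sigma]
  refine Finset.sum_congr rfl fun i _ ↦ ?_
  simp only [Matrix.diag_apply, LinearMap.toMatrix_apply, Fintype.sum_prod_type,
    LinearMap.mulLeft_apply, Pi.basis_apply, Pi.basis_repr, stdBasis_eq_single, Pi.mul_apply,
    Pi.single_eq_same]
  have hrepr (M : Matrix (Fin (d i)) (Fin (d i)) K) (x y : Fin (d i)) :
      (stdBasis K (Fin (d i)) (Fin (d i))).repr M (x, y) = M x y := by
    simp [stdBasis]
  simp [hrepr, Matrix.trace, Finset.mul_sum]

end Matrix

theorem MonoidAlgebra.trace_mulLeft_of {K G : Type*} [Field K] [Group G] [Finite G] {g : G}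
    (hg : g ≠ 1) :
    LinearMap.trace K _ (LinearMap.mulLeft K (MonoidAlgebra.of K G g)) = 0 := by
  classical
  have := Fintype.ofFinite G
  rw [LinearMap.trace_eq_matrix_trace K (MonoidAlgebra.basis G K)]
  refine Finset.sum_eq_zero fun x _ ↦ ?_
  rw [Matrix.diag_apply, LinearMap.toMatrix_apply]
  simp [MonoidAlgebra.basis, hg]

theorem Representation.isIrreducible_of_surjective_matrix {K G : Type*} [Field K] [Group G]
    {n : ℕ} [NeZero n] (φ : MonoidAlgebra K G →ₐ[K] Matrix (Fin n) (Fin n) K)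
    (hφ : Function.Surjective φ) :
    IsIrreducible ((MonoidAlgebra.lift K (Module.End K (Fin n → K)) G).symm
      (Matrix.toLinAlgEquiv'.toAlgHom.comp φ)) := by
  rw [isIrreducible_iff_forall_submodule]
  refine ⟨inferInstance, fun U hU ↦ or_iff_not_imp_left.mpr fun hne ↦ ?_⟩
  have hmat (a : MonoidAlgebra K G) : ∀ v ∈ U, (φ a).mulVec v ∈ U := by
    induction a using MonoidAlgebra.induction_on with
    | of g =>
      intro v hv
      simpa using hU g v hv
    | add a b ha hb =>
      intro v hv
      rw [map_add, Matrix.add_mulVec]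
      exact U.add_mem (ha v hv) (hb v hv)
    | smul c a ha =>
      intro v hv
      rw [map_smul, Matrix.smul_mulVec]
      exact U.smul_mem c (ha v hv)
  obtain ⟨v, hv, hv0⟩ := U.exists_mem_ne_zero_of_ne_bot hne
  obtain ⟨i, hi⟩ := Function.ne_iff.mp hv0
  rw [eq_top_iff]
  intro w _
  obtain ⟨a, ha⟩ := hφ (Matrix.vecMulVec w (Pi.single i (v i)⁻¹))
  have := hmat a v hv
  rw [ha, Matrix.vecMulVec_mulVec] at this
  simpa [inv_mul_cancel₀ hi] using this

theorem Matrix.eq_one_of_algHom {K : Type*} [Field K] {n : ℕ} [NeZero n]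
    (f : Matrix (Fin n) (Fin n) K →ₐ[K] K) : n = 1 := by
  have h := LinearMap.finrank_le_finrank_of_injective (f := f.toLinearMap)
    (f : Matrix (Fin n) (Fin n) K →+* K).injective
  rw [finrank_matrix, finrank_self, mul_one, Fintype.card_fin] at h
  have := NeZero.pos n
  nlinarith

theorem exists_eq_one_of_algHom_pi_matrix {K ι : Type*} [Field K] [Fintype ι] [DecidableEq ι]
    (d : ι → ℕ) [∀ i, NeZero (d i)]
    (f : (Π i, Matrix (Fin (d i)) (Fin (d i)) K) →ₐ[K] K) : ∃ i, d i = 1 := by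
  obtain ⟨i, hi⟩ : ∃ i, f (Pi.single i 1) ≠ 0 := by
    by_contra! h
    have h1 : (1 : Π i, Matrix (Fin (d i)) (Fin (d i)) K) = ∑ i, Pi.single i 1 :=
      (Finset.univ_sum_single _).symm
    have := map_one f
    rw [h1, map_sum, Finset.sum_eq_zero fun i _ ↦ h i] at this
    exact zero_ne_one this
  refine ⟨i, Matrix.eq_one_of_algHom (AlgHom.ofLinearMap
    (f.toLinearMap ∘ₗ LinearMap.single K (fun i ↦ Matrix (Fin (d i)) (Fin (d i)) K) i) ?_ fun a b ↦ ?_)⟩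
  · have h : f (Pi.single i 1) * f (Pi.single i 1) = f (Pi.single i 1) := by
      rw [← map_mul, ← Pi.single_mul, one_mul]
    exact mul_left_cancel₀ hi (by rw [mul_one]; exact h)
  · change f (Pi.single i (a * b)) = f (Pi.single i a) * f (Pi.single i b)
    rw [Pi.single_mul, map_mul]

theorem not_isIntegral_of_natCast_mul_eq_one {K : Type*} [Field K] [CharZero K] {p : ℕ}
    (hp : p.Prime) {x : K} (hx : IsIntegral ℤ x) : (p : K) * x ≠ 1 := by
  intro h
  have hp0 : (p : ℚ) ≠ 0 := Nat.cast_ne_zero.mpr hp.ne_zero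
  have hxq : x = algebraMap ℚ K (p : ℚ)⁻¹ := by
    rw [map_inv₀, map_natCast]
    exact eq_inv_of_mul_eq_one_right h
  rw [hxq, isIntegral_algebraMap_iff (algebraMap ℚ K).injective,
    IsIntegrallyClosed.isIntegral_iff] at hx
  obtain ⟨y, hy⟩ := hx
  have : (p : ℤ) * y = 1 := by
    have : (p : ℚ) * y = 1 := by
      rw [show (y : ℚ) = (p : ℚ)⁻¹ from hy, mul_inv_cancel₀ hp0]
    exact_mod_cast this
  have h1 := Int.natAbs_dvd_natAbs.mpr (Dvd.intro _ this)
  exact hp.one_lt.ne' (Nat.dvd_one.mp (by simpa using h1))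

/-- A finite perfect group whose irreducible complex representations all have dimension a power
of a prime `p` is trivial: otherwise the regular character at `g ≠ 1` would exhibit `1 / p` as an
algebraic integer. -/
theorem subsingleton_of_commutator_eq_top {G : Type} [Group G] [Finite G] {p : ℕ} (hp : p.Prime)
    (hG : commutator G = ⊤)
    (h : ∀ (n : ℕ) (ρ : Representation ℂ G (Fin n → ℂ)), ρ.IsIrreducible → ∃ k, n = p ^ k) :
    Subsingleton G := by
  by_contra hsub
  rw [not_subsingleton_iff_nontrivial] at hsub
  obtain ⟨g, hg⟩ := exists_ne (1 : G)
  have : NeZero (Nat.card G : ℂ) := ⟨Nat.cast_ne_zero.mpr Nat.card_pos.ne'⟩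
  have : FiniteDimensional ℂ (MonoidAlgebra ℂ G) := .of_basis (MonoidAlgebra.basis G ℂ)
  obtain ⟨m, d, hd, ⟨e⟩⟩ :=
    IsSemisimpleRing.exists_algEquiv_pi_matrix_of_isAlgClosed ℂ (MonoidAlgebra ℂ G)
  let π (i : Fin m) : MonoidAlgebra ℂ G →ₐ[ℂ] Matrix (Fin (d i)) (Fin (d i)) ℂ :=
    (Pi.evalAlgHom ℂ _ i).comp e.toAlgHom
  have hπ (i) : Function.Surjective (π i) := (Function.surjective_eval i).comp e.surjective
  have hpow (i) : ∃ k, d i = p ^ k :=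
    h _ _ (Representation.isIrreducible_of_surjective_matrix (π i) (hπ i))
  let ε : MonoidAlgebra ℂ G →ₐ[ℂ] ℂ := MonoidAlgebra.lift ℂ ℂ G 1
  have hone (i) (hi : d i = 1) (x : G) : π i (MonoidAlgebra.of ℂ G x) = 1 := by
    let χ : G →* ℂ := Matrix.detMonoidHom.comp ((MonoidAlgebra.lift ℂ _ G).symm (π i))
    have hχ : χ x = 1 := by
      have hker := Abelianization.commutator_subset_ker χ.toHomUnits
      rw [hG] at hker
      exact congrArg Units.val (hker (Subgroup.mem_top x))
    have : Subsingleton (Fin (d i)) := by rw [hi]; infer_instance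
    refine Matrix.ext fun a b ↦ ?_
    rw [Subsingleton.elim a b, Matrix.one_apply_eq]
    exact (Matrix.det_eq_elem_of_subsingleton _ b).symm.trans hχ
  have haug (i) (hi : d i = 1) (a) : π i a = algebraMap ℂ _ (ε a) := by
    have : π i = (Algebra.ofId ℂ _).comp ε := by
      refine (MonoidAlgebra.lift ℂ _ G).symm.injective (MonoidHom.ext fun x ↦ (hone i hi x).trans ?_)
      simp [ε]
    rw [this]
    rfl
  obtain ⟨i₀, hi₀⟩ := exists_eq_one_of_algHom_pi_matrix d (ε.comp e.symm.toAlgHom)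
  have huniq (i) (hi : d i = 1) : i = i₀ := by
    by_contra hne
    have h1 := haug i hi (e.symm (Pi.single i 1))
    have h2 := haug i₀ hi₀ (e.symm (Pi.single i 1))
    have h3 : π i₀ (e.symm (Pi.single i 1)) = 0 := by simp [π, Ne.symm hne]
    have h4 : π i (e.symm (Pi.single i 1)) = 1 := by simp [π]
    rw [h3] at h2
    rw [← (FaithfulSMul.algebraMap_injective ℂ _).eq_iff.mp (h2.symm.trans (map_zero _).symm).symm,
      map_zero, h4] at h1
    exact one_ne_zero h1
  have hdvd (i) (hi : i ≠ i₀) : p ∣ d i := by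
    obtain ⟨k, hk⟩ := hpow i
    rw [hk]
    refine dvd_pow_self p fun h0 ↦ hi (huniq i ?_)
    rw [hk, h0, pow_zero]
  have hsum : ∑ i, (d i : ℂ) * (π i (MonoidAlgebra.of ℂ G g)).trace = 0 := by
    rw [← MonoidAlgebra.trace_mulLeft_of (K := ℂ) hg, ← LinearMap.trace_conj' _ e.toLinearEquiv]
    refine (Matrix.trace_mulLeft_pi d (e (MonoidAlgebra.of ℂ G g))).symm.trans ?_
    congr 1
    refine LinearMap.ext fun a ↦ ?_
    simp [LinearEquiv.conj_apply]
  choose! c hc using hdvd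
  rw [← Finset.add_sum_erase _ _ (Finset.mem_univ i₀), hone i₀ hi₀, Matrix.trace_one,
    Fintype.card_fin, hi₀] at hsum
  refine not_isIntegral_of_natCast_mul_eq_one hp (K := ℂ)
    (x := -∑ i ∈ Finset.univ.erase i₀, (c i : ℂ) * (π i (MonoidAlgebra.of ℂ G g)).trace) ?_ ?_
  · refine (IsIntegral.sum _ fun i _ ↦ (isIntegral_algebraMap (x := (c i : ℤ))).mul ?_).neg
    refine Matrix.isIntegral_trace_of_pow_eq_one (orderOf_pos g) _ ?_
    rw [← map_pow, ← map_pow, pow_orderOf_eq_one, map_one, map_one]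
  · rw [mul_neg, Finset.mul_sum, neg_eq_iff_add_eq_zero, add_comm, ← hsum]
    congr 1
    · simp
    · refine Finset.sum_congr rfl fun i hi ↦ ?_
      have hci : (d i : ℂ) = p * c i := by exact_mod_cast hc i (Finset.ne_of_mem_erase hi)
      rw [hci, mul_assoc]

theorem isSolvable_of_forall_isIrreducible_finrank_eq_prime_pow {p : ℕ} (hp : p.Prime) (n : ℕ) :
    ∀ (G : Type) [Group G] [Finite G], Nat.card G = n →
      (∀ (V : Type) [AddCommGroup V] [Module ℂ V] [FiniteDimensional ℂ V]
        (ρ : Representation ℂ G V), ρ.IsIrreducible → ∃ k, finrank ℂ V = p ^ k) →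
      Group.IsSolvable G := by
  induction n using Nat.strong_induction_on with
  | _ n ih =>
    intro G _ _ hn h
    by_cases hG : commutator G = ⊤
    · have := subsingleton_of_commutator_eq_top hp hG fun n ρ hρ ↦ by simpa using h _ ρ hρ
      infer_instance
    · have hlt : Nat.card (commutator G) < n := by
        rw [← hn]
        exact (Subgroup.card_le_card_group _).lt_of_ne fun H ↦ hG (Subgroup.eq_top_of_card_eq _ H)
      have := ih _ hlt (commutator G) rfl fun S _ _ _ σ hσ ↦ by
        obtain ⟨V, _, _, _, ρ, hρ, hdvd⟩ :=
          Representation.exists_isIrreducible_finrank_dvd (commutator G) σ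
        obtain ⟨k, hk⟩ := h V ρ hρ
        rw [hk] at hdvd
        obtain ⟨j, -, hj⟩ := (Nat.dvd_prime_pow hp).mp hdvd
        exact ⟨j, hj⟩
      exact Group.isSolvable_of_ker_le_range (commutator G).subtype (Abelianization.of (G := G))
        (by rw [Abelianization.ker_of, Subgroup.range_subtype])

/-- Isaacs–Passman: if every irreducible complex representation of a finite group `G`
has dimension a power of a fixed prime `p`, then `G` is solvable. -/
theorem stmt_8 (G : Type) [Group G] [Fintype G] (p : ℕ) (hp : p.Prime)
    (h : ∀ V : FDRep ℂ G, CategoryTheory.Simple V → ∃ k : ℕ, Module.finrank ℂ V = p ^ k) :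
    IsSolvable G :=
  isSolvable_of_forall_isIrreducible_finrank_eq_prime_pow hp _ G rfl fun _ _ _ _ ρ _ ↦
    h (FDRep.of ρ) (Representation.simple_fdRep_of_isIrreducible ρ)
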